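/- For every integer C ≥ 2 and every strictly positive finite joint pmf w on β × α with MI(w) = 0, every strictly positive similarity score S : β × α → ℝ satisfies L(S) ≥ log(C - 1). (This is the corollary stated in Section 2: if the attacker can force the mutual information between the perturbed input and the in-class reference data to zero, then the ASK loss cannot be smaller than log(C - 1).) -/

import Mathlib

open Finset

/-- Marginal of the perturbed input: `μ(x') = Σ_x w(x', x)`. -/
noncomputable def askMargMu {α β : Type*} [Fintype α] (w : β × α → ℝ) (x' : β) : ℝ :=
  ∑ x : α, w (x', x)

/-- Marginal of the reference data: `m(x) = Σ_{x'} w(x', x)`. -/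
noncomputable def askMargM {α β : Type*} [Fintype β] (w : β × α → ℝ) (x : α) : ℝ :=
  ∑ x' : β, w (x', x)

/-- Mutual information of a finite joint pmf `w` on `β × α`. -/
noncomputable def askMI {α β : Type*} [Fintype α] [Fintype β] (w : β × α → ℝ) : ℝ :=
  ∑ x' : β, ∑ x : α,
    w (x', x) * Real.log (w (x', x) / (askMargMu w x' * askMargM w x))

/-- The Adversarial Soft kNN (ASK) loss with `C` classes, joint pmf `w`, and
similarity score `S`. -/
noncomputable def askLoss {α β : Type*} [Fintype α] [Fintype β] (C : ℕ)
    (w : β × α → ℝ) (S : β × α → ℝ) : ℝ :=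
  - ∑ x' : β, ∑ x₁ : α, ∑ t : Fin (C - 1) → α,
      w (x', x₁) * (∏ i, askMargM w (t i)) *
        Real.log (S (x', x₁) / (S (x', x₁) + ∑ i, S (x', t i)))

theorem sub_le_mul_log_div {a b : ℝ} (ha : 0 < a) (hb : 0 < b) :
    a - b ≤ a * Real.log (a / b) := by
  have h := Real.log_le_sub_one_of_pos (div_pos hb ha)
  rw [← inv_div, Real.log_inv]
  have h2 := mul_le_mul_of_nonneg_left h ha.le
  have h3 : a * (b / a - 1) = b - a := by field_simp
  linarith

theorem eq_of_mul_log_div_eq_sub {a b : ℝ} (ha : 0 < a) (hb : 0 < b)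
    (hab : a * Real.log (a / b) = a - b) : a = b := by
  by_contra hne
  have h1 : b / a ≠ 1 := fun h ↦ hne ((div_eq_one_iff_eq ha.ne').1 h).symm
  have h := Real.log_lt_sub_one_of_pos (div_pos hb ha) h1
  rw [← inv_div, Real.log_inv] at hab
  have h2 := mul_lt_mul_of_pos_left h ha
  have h3 : a * (b / a - 1) = b - a := by field_simp
  linarith

section Marginals

variable {α β : Type*} [Fintype α] [Fintype β] {w : β × α → ℝ}

theorem sum_askMargMu : ∑ x', askMargMu w x' = ∑ p, w p := by
  simp only [askMargMu, Fintype.sum_prod_type]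

theorem sum_askMargM : ∑ x, askMargM w x = ∑ p, w p := by
  simp only [askMargM, Fintype.sum_prod_type_right]

/-- A strictly positive joint pmf with zero mutual information is the product of its marginals. -/
theorem eq_mul_of_askMI_eq_zero (hw_pos : ∀ p, 0 < w p) (hw_sum : ∑ p, w p = 1)
    (hMI : askMI w = 0) (x' : β) (x : α) : w (x', x) = askMargMu w x' * askMargM w x := by
  have hq : ∀ p : β × α, 0 < askMargMu w p.1 * askMargM w p.2 := fun p ↦
    mul_pos (sum_pos (fun _ _ ↦ hw_pos _) ⟨p.2, mem_univ _⟩)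
      (sum_pos (fun _ _ ↦ hw_pos _) ⟨p.1, mem_univ _⟩)
  have hq_sum : ∑ p : β × α, askMargMu w p.1 * askMargM w p.2 = 1 := by
    rw [Fintype.sum_prod_type, ← Finset.sum_mul_sum, sum_askMargMu, sum_askMargM, hw_sum, one_mul]
  have hsum : ∑ p : β × α, (w p - askMargMu w p.1 * askMargM w p.2) =
      ∑ p : β × α, w p * Real.log (w p / (askMargMu w p.1 * askMargM w p.2)) := by
    rw [sum_sub_distrib, hw_sum, hq_sum, sub_self, Fintype.sum_prod_type]
    exact hMI.symm
  have h := (sum_eq_sum_iff_of_le fun p _ ↦ sub_le_mul_log_div (hw_pos p) (hq p)).1 hsum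
    (x', x) (mem_univ _)
  exact eq_of_mul_log_div_eq_sub (hw_pos _) (hq (x', x)) h.symm

end Marginals

section ProductWeights

variable {α ι : Type*} [Fintype α] [Fintype ι] [DecidableEq ι] {m : α → ℝ}

theorem sum_prod_eq_one (hm : ∑ x, m x = 1) : ∑ t : ι → α, ∏ i, m (t i) = 1 := by
  rw [← Fintype.piFinset_univ, ← prod_univ_sum (fun _ ↦ univ) (fun _ ↦ m)]
  simp [hm]

theorem sum_prod_mul_apply (hm : ∑ x, m x = 1) (f : α → ℝ) (j : ι) :
    ∑ t : ι → α, (∏ i, m (t i)) * f (t j) = ∑ x, m x * f x := by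
  have h : ∀ t : ι → α, (∏ i, m (t i)) * f (t j) =
      ∏ i, m (t i) * (if i = j then f (t i) else 1) := fun t ↦ by
    rw [prod_mul_distrib, prod_ite_eq' univ j, if_pos (mem_univ j)]
  simp_rw [h]
  rw [← Fintype.piFinset_univ,
    ← prod_univ_sum (fun _ ↦ univ) (fun i x ↦ m x * (if i = j then f x else 1)),
    prod_eq_single j]
  · simp
  · intro i _ hi
    simp [hi, hm]
  · simp

end ProductWeights

theorem log_card_add_mean_log_le_log_sum {ι : Type*} [Fintype ι] [Nonempty ι] {s : ι → ℝ}
    (hs : ∀ i, 0 < s i) :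
    Real.log (Fintype.card ι) + (Fintype.card ι : ℝ)⁻¹ * ∑ i, Real.log (s i) ≤
      Real.log (∑ i, s i) := by
  have hn : (0 : ℝ) < Fintype.card ι := by exact_mod_cast Fintype.card_pos
  have h := strictConcaveOn_log_Ioi.concaveOn.le_map_sum (t := univ)
    (w := fun _ : ι ↦ (Fintype.card ι : ℝ)⁻¹) (p := s) (fun _ _ ↦ by positivity)
    (by simp [hn.ne']) (fun i _ ↦ hs i)
  simp only [smul_eq_mul, ← mul_sum] at h
  have hT : 0 < ∑ i, s i := sum_pos (fun i _ ↦ hs i) univ_nonempty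
  rw [Real.log_mul (by positivity) hT.ne', Real.log_inv] at h
  linarith

theorem log_div_add_sum_le {ι : Type*} [Fintype ι] [Nonempty ι] {s : ι → ℝ}
    (hs : ∀ i, 0 < s i) {a : ℝ} (ha : 0 < a) :
    Real.log (a / (a + ∑ i, s i)) ≤
      Real.log a - Real.log (Fintype.card ι) -
        (Fintype.card ι : ℝ)⁻¹ * ∑ i, Real.log (s i) := by
  have hT : 0 < ∑ i, s i := sum_pos (fun i _ ↦ hs i) univ_nonempty
  rw [Real.log_div ha.ne' (by positivity)]
  have h1 := log_card_add_mean_log_le_log_sum hs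
  have h2 : Real.log (∑ i, s i) ≤ Real.log (a + ∑ i, s i) := Real.log_le_log hT (by linarith)
  linarith

/-- For i.i.d. samples, the expected log-ratio of one score to the total of all scores is at most
minus the log of the number of competing scores. -/
theorem sum_mul_log_div_add_sum_le {α ι : Type*} [Fintype α] [Fintype ι] [DecidableEq ι]
    [Nonempty ι] {m s : α → ℝ} (hm : ∀ x, 0 ≤ m x) (hm_sum : ∑ x, m x = 1) (hs : ∀ x, 0 < s x) :
    ∑ x, ∑ t : ι → α, m x * (∏ i, m (t i)) * Real.log (s x / (s x + ∑ i, s (t i))) ≤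
      -Real.log (Fintype.card ι) := by
  have hn : (Fintype.card ι : ℝ) ≠ 0 := by exact_mod_cast Fintype.card_ne_zero
  set E := ∑ x, m x * Real.log (s x) with hE
  have hmean : ∑ t : ι → α, (∏ i, m (t i)) *
      ((Fintype.card ι : ℝ)⁻¹ * ∑ j, Real.log (s (t j))) = E := by
    simp_rw [mul_left_comm _ (Fintype.card ι : ℝ)⁻¹, mul_sum (s := (univ : Finset ι))]
    rw [sum_comm]
    simp_rw [← mul_sum, sum_prod_mul_apply hm_sum (fun x ↦ Real.log (s x))]
    simp [← hE, hn]
  have hinner : ∀ x, ∑ t : ι → α, (∏ i, m (t i)) *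
      (Real.log (s x) - Real.log (Fintype.card ι) -
        (Fintype.card ι : ℝ)⁻¹ * ∑ j, Real.log (s (t j))) =
      Real.log (s x) - Real.log (Fintype.card ι) - E := fun x ↦ by
    simp_rw [mul_sub _ (Real.log (s x) - Real.log (Fintype.card ι))]
    rw [sum_sub_distrib, hmean, ← sum_mul, sum_prod_eq_one hm_sum, one_mul]
  calc _ ≤ ∑ x, m x * ∑ t : ι → α, (∏ i, m (t i)) *
        (Real.log (s x) - Real.log (Fintype.card ι) -
          (Fintype.card ι : ℝ)⁻¹ * ∑ j, Real.log (s (t j))) := by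
        simp_rw [mul_sum (s := (univ : Finset (ι → α))), ← mul_assoc (m _)]
        exact sum_le_sum fun x _ ↦ sum_le_sum fun t _ ↦
          mul_le_mul_of_nonneg_left (log_div_add_sum_le (fun i ↦ hs (t i)) (hs x))
            (mul_nonneg (hm x) (prod_nonneg fun i _ ↦ hm (t i)))
    _ = -Real.log (Fintype.card ι) := by
        simp_rw [hinner, mul_sub, sum_sub_distrib, ← sum_mul, hm_sum]
        rw [← hE]
        ring

/-- Corollary of Theorem 1 (Section 2 of the ASK paper): if the attacker can
force the mutual information between the perturbed input and the in-class
reference data to zero, then the ASK loss cannot be smaller than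
`log (C - 1)`. -/
theorem ask_loss_lower_bound_of_zero_MI
    {α β : Type*} [Fintype α] [Fintype β]
    (C : ℕ) (hC : 2 ≤ C)
    (w : β × α → ℝ) (hw_pos : ∀ p : β × α, 0 < w p)
    (hw_sum : ∑ p : β × α, w p = 1)
    (hMI : askMI w = 0)
    (S : β × α → ℝ) (hS_pos : ∀ p : β × α, 0 < S p) :
    askLoss C w S ≥ Real.log ((C : ℝ) - 1) := by
  have hprod := eq_mul_of_askMI_eq_zero hw_pos hw_sum hMI
  have : Nonempty (Fin (C - 1)) := ⟨⟨0, by omega⟩⟩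
  have hcard : ((Fintype.card (Fin (C - 1)) : ℕ) : ℝ) = (C : ℝ) - 1 := by
    rw [Fintype.card_fin, Nat.cast_sub (by omega), Nat.cast_one]
  have hμ : ∀ x', 0 ≤ askMargMu w x' := fun x' ↦ sum_nonneg fun _ _ ↦ (hw_pos _).le
  have hm : ∀ x, 0 ≤ askMargM w x := fun x ↦ sum_nonneg fun _ _ ↦ (hw_pos _).le
  have key := sum_le_sum fun (x' : β) (_ : x' ∈ univ) ↦ mul_le_mul_of_nonneg_left
    (sum_mul_log_div_add_sum_le (ι := Fin (C - 1)) (s := fun x ↦ S (x', x)) hm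
      (sum_askMargM.trans hw_sum) fun x ↦ hS_pos (x', x)) (hμ x')
  rw [← sum_mul, sum_askMargMu, hw_sum, one_mul, hcard] at key
  rw [ge_iff_le, askLoss, le_neg]
  refine le_of_eq_of_le ?_ key
  simp_rw [hprod, mul_sum, mul_assoc]
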